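/- G_φ admits a temporal spanning tree if and only if the CNF formula φ is satisfiable. -/

import Mathlib

namespace TemporalPaper

/-- A temporal graph on vertex set `V`: an undirected labeling assigning to each
(unordered) pair of vertices a finite set of rational time labels; a pair is an
edge of the graph iff its label set is nonempty. -/
structure TemporalGraph (V : Type*) where
  label : V → V → Finset ℚ
  symm : ∀ u v, label u v = label v u
  loopless : ∀ v, label v v = ∅

namespace TemporalGraph

variable {V : Type*}

/-- The footprint (static underlying graph) of a temporal graph. -/
def footprint (G : TemporalGraph V) : SimpleGraph V where
  Adj u v := (G.label u v).Nonempty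
  symm := ⟨fun u v h => by rwa [G.symm]⟩
  loopless := ⟨fun v h => by rw [G.loopless] at h; exact Finset.not_nonempty_empty h⟩

/-- The snapshot of a temporal graph at time `t`. -/
def snapshot (G : TemporalGraph V) (t : ℚ) : SimpleGraph V where
  Adj u v := t ∈ G.label u v
  symm := ⟨fun u v h => by rwa [G.symm]⟩
  loopless := ⟨fun v h => by rw [G.loopless] at h; exact absurd h (Finset.notMem_empty t)⟩

/-- `G.IsTJ r p ts` : the list of vertices `p` together with the list of times `ts`
(one per consecutive pair of vertices of `p`) forms a temporal walk, i.e. each time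
belongs to the labels of the corresponding edge, and consecutive times satisfy `r`
(`r = (· ≤ ·)` for non-strict temporal walks, `r = (· < ·)` for strict ones). -/
inductive IsTJ (G : TemporalGraph V) (r : ℚ → ℚ → Prop) : List V → List ℚ → Prop
  | single (v : V) : IsTJ G r [v] []
  | cons {u v : V} {p : List V} {t : ℚ} {ts : List ℚ} :
      t ∈ G.label u v → IsTJ G r (v :: p) ts →
      (∀ t' ∈ ts.head?, r t t') → IsTJ G r (u :: v :: p) (t :: ts)

/-- A temporal path from `u` to `v` with underlying (vertex-)path `p` and times `ts`. -/
def TPath (G : TemporalGraph V) (r : ℚ → ℚ → Prop) (u v : V)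
    (p : List V) (ts : List ℚ) : Prop :=
  G.IsTJ r p ts ∧ p.Nodup ∧ p.head? = some u ∧ p.getLast? = some v

/-- Temporal reachability. -/
def Reach (G : TemporalGraph V) (r : ℚ → ℚ → Prop) (u v : V) : Prop :=
  ∃ p ts, G.TPath r u v p ts

def TemporallyConnectedRel (G : TemporalGraph V) (r : ℚ → ℚ → Prop) : Prop :=
  ∀ u v : V, u ≠ v → G.Reach r u v

/-- Temporal connectivity (non-strict setting). -/
def TemporallyConnected (G : TemporalGraph V) : Prop :=
  G.TemporallyConnectedRel (· ≤ ·)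

/-- A bidirectional temporal path (bi-path) between `u` and `v` on the underlying
path `p` (from `u` to `v`): a temporal path in each direction along `p`. -/
def BiPath (G : TemporalGraph V) (r : ℚ → ℚ → Prop) (u v : V)
    (p : List V) (ts₁ ts₂ : List ℚ) : Prop :=
  G.TPath r u v p ts₁ ∧ G.TPath r v u p.reverse ts₂

def BiConnectedRel (G : TemporalGraph V) (r : ℚ → ℚ → Prop) : Prop :=
  ∀ u v : V, u ≠ v → ∃ p ts₁ ts₂, G.BiPath r u v p ts₁ ts₂

/-- Bidirectional temporal connectivity (non-strict setting). -/
def BiConnected (G : TemporalGraph V) : Prop := G.BiConnectedRel (· ≤ ·)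

/-- `H` is a temporal subgraph of `G` (on the same vertex set). -/
def IsSubgraph (H G : TemporalGraph V) : Prop := ∀ u v, H.label u v ⊆ G.label u v

/-- A temporal spanner of `G`: a temporally connected temporal subgraph on all of `V`. -/
def IsSpanner (H G : TemporalGraph V) : Prop := H.IsSubgraph G ∧ H.TemporallyConnected

/-- A temporal spanning tree of `G`: a temporal spanner whose footprint is a tree. -/
def IsSpanningTree (H G : TemporalGraph V) : Prop := H.IsSpanner G ∧ H.footprint.IsTree

/-- A bidirectional temporal spanner (bi-spanner) of `G`. -/
def IsBiSpanner (H G : TemporalGraph V) : Prop := H.IsSpanner G ∧ H.BiConnected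

/-- A temporal graph is simple if every edge has exactly one time label,
i.e. every label set has at most one element (edges have nonempty label sets). -/
def Simple (G : TemporalGraph V) : Prop := ∀ u v, (G.label u v).card ≤ 1

/-- A temporal graph is proper if any two (distinct) edges sharing a vertex have
disjoint label sets. -/
def Proper (G : TemporalGraph V) : Prop :=
  ∀ u v w : V, v ≠ w → Disjoint (G.label u v) (G.label u w)

def Happy (G : TemporalGraph V) : Prop := G.Simple ∧ G.Proper

/-- `u` can reach `v` by a (non-strict) temporal path arriving at time at most `t`. -/
def ArrivesBy (G : TemporalGraph V) (u v : V) (t : ℚ) : Prop :=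
  ∃ p ts, G.TPath (· ≤ ·) u v p ts ∧ ∀ t' ∈ ts.getLast?, t' ≤ t

/-- `u` can reach `v` by a (non-strict) temporal path departing at time at least `t`. -/
def DepartsAfter (G : TemporalGraph V) (u v : V) (t : ℚ) : Prop :=
  ∃ p ts, G.TPath (· ≤ ·) u v p ts ∧ ∀ t' ∈ ts.head?, t ≤ t'

/-- A pivot: some time `t` such that every other vertex reaches `x` by time `t`
and `x` reaches every other vertex departing not earlier than `t`. -/
def IsPivot (G : TemporalGraph V) (x : V) : Prop :=
  ∃ t : ℚ, ∀ u : V, u ≠ x → G.ArrivesBy u x t ∧ G.DepartsAfter x u t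

/-- Deleting the (undirected) edge `ab` from a temporal graph. -/
def deleteEdge [DecidableEq V] (G : TemporalGraph V) (a b : V) : TemporalGraph V where
  label u v := if (u = a ∧ v = b) ∨ (u = b ∧ v = a) then ∅ else G.label u v
  symm := by
    intro u v
    have h : ((u = a ∧ v = b) ∨ (u = b ∧ v = a)) ↔ ((v = a ∧ u = b) ∨ (v = b ∧ u = a)) := by
      tauto
    rw [G.symm, if_congr h rfl rfl]
  loopless := by
    intro v
    split_ifs with h
    · rfl
    · exact G.loopless v

end TemporalGraph

end TemporalPaper

namespace TemporalPaper

open TemporalGraph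

/-- Vertices of the temporal graph `G_φ` built from a CNF formula `φ` with `n`
variables and `k` clauses: one vertex per variable, one per clause, and three special
vertices `T`, `F`, `B`. -/
inductive Vphi (n k : ℕ) : Type
  | var : Fin n → Vphi n k
  | cls : Fin k → Vphi n k
  | T : Vphi n k
  | F : Vphi n k
  | B : Vphi n k
deriving DecidableEq

/-- The reference time `t⁺ = n + k + 1`. -/
def tpos (n k : ℕ) : ℚ := n + k + 1

/-- The reference time `t⁻ = -t⁺`. -/
def tneg (n k : ℕ) : ℚ := -(tpos n k)

/-- The value `ε`, a fixed rational with `0 < ε < 1`. -/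
def eps : ℚ := 1/2

/-- One orientation of the labeling of `G_φ`. The formula `φ` is encoded by
`φ j i = some true` if variable `x_i` occurs positively in clause `c_j`,
`φ j i = some false` if it occurs negatively, and `φ j i = none` if it does not occur
(so no clause contains both a variable and its negation). Variable and clause indices
are taken `1`-based (`i+1`, `j+1`) as in the paper. -/
def corePhi (n k : ℕ) (φ : Fin k → Fin n → Option Bool) :
    Vphi n k → Vphi n k → Finset ℚ
  | .B, .T => {tneg n k, eps}
  | .B, .F => {-eps, tpos n k}
  | .T, .var i => {tneg n k - ((i : ℚ) + 1), (i : ℚ) + 1}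
  | .F, .var i => {-((i : ℚ) + 1), tpos n k + ((i : ℚ) + 1)}
  | .var i, .cls j =>
      match φ j i with
      | some true => {tneg n k - (((i : ℚ) + 1) + ((j : ℚ) + 1)),
                      ((i : ℚ) + 1) + ((j : ℚ) + 1)}
      | some false => {-(((i : ℚ) + 1) + ((j : ℚ) + 1)),
                       tpos n k + (((i : ℚ) + 1) + ((j : ℚ) + 1))}
      | none => ∅
  | _, _ => ∅

/-- The temporal graph `G_φ` of the reduction from SAT to TST. -/
def Gphi (n k : ℕ) (φ : Fin k → Fin n → Option Bool) : TemporalGraph (Vphi n k) where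
  label u v := corePhi n k φ u v ∪ corePhi n k φ v u
  symm := fun u v => Finset.union_comm _ _
  loopless := fun v => by cases v <;> rfl

/-- The edge `x_i c_j` is a positive edge of `G_φ`. -/
def PosEdge {n k : ℕ} (φ : Fin k → Fin n → Option Bool) (i : Fin n) (j : Fin k) : Prop :=
  φ j i = some true

/-- The edge `x_i c_j` is a negative edge of `G_φ`. -/
def NegEdge {n k : ℕ} (φ : Fin k → Fin n → Option Bool) (i : Fin n) (j : Fin k) : Prop :=
  φ j i = some false

/-- `φ` is satisfiable: some assignment makes a literal of every clause true. -/
def Satisfiable {n k : ℕ} (φ : Fin k → Fin n → Option Bool) : Prop :=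
  ∃ σ : Fin n → Bool, ∀ j : Fin k, ∃ i : Fin n, ∃ b : Bool, φ j i = some b ∧ σ i = b

end TemporalPaper

namespace TemporalPaper

open TemporalGraph

namespace TemporalGraph

variable {V : Type*}

/-- `G.TWalk s u v`: there is a non-strict temporal walk from `u` to `v` in `G` all of whose
times are at least `s`. -/
inductive TWalk (G : TemporalGraph V) : ℚ → V → V → Prop
  | refl (s : ℚ) (v : V) : TWalk G s v v
  | step {s t : ℚ} {u w v : V} : s ≤ t → t ∈ G.label u w → TWalk G t w v → TWalk G s u v

lemma IsTJ.exists_suffix {G : TemporalGraph V} {r : ℚ → ℚ → Prop} {p : List V} {ts : List ℚ}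
    (h : G.IsTJ r p ts) {u : V} (hu : u ∈ p) :
    ∃ q ts', q <:+ p ∧ ts' <:+ ts ∧ G.IsTJ r q ts' ∧ q.head? = some u ∧
      q.getLast? = p.getLast? := by
  induction h with
  | single v =>
    obtain rfl : u = v := by simpa using hu
    exact ⟨[u], [], List.suffix_rfl, List.suffix_rfl, .single u, rfl, rfl⟩
  | @cons a b p t ts hl ht hr ih =>
    rcases List.mem_cons.1 hu with rfl | hu
    · exact ⟨_, _, List.suffix_rfl, List.suffix_rfl, .cons hl ht hr, rfl, rfl⟩
    · obtain ⟨q, ts', hq, hts, hj, hh, hlast⟩ := ih hu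
      refine ⟨q, ts', hq.trans (List.suffix_cons _ _), hts.trans (List.suffix_cons _ _), hj, hh, ?_⟩
      rw [hlast, List.getLast?_cons_cons]

lemma TWalk.exists_tPath {G : TemporalGraph V} {s : ℚ} {u v : V} (h : G.TWalk s u v) :
    ∃ p ts, G.TPath (· ≤ ·) u v p ts ∧ ∀ t ∈ ts, s ≤ t := by
  induction h with
  | refl s v => exact ⟨[v], [], ⟨.single v, by simp, rfl, rfl⟩, by simp⟩
  | @step s t u w v hst hl _ ih =>
    obtain ⟨p, ts, ⟨hj, hn, hh, hlast⟩, hts⟩ := ih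
    by_cases hu : u ∈ p
    · obtain ⟨q, ts', hq, hts', hj', hh', hlast'⟩ := hj.exists_suffix hu
      exact ⟨q, ts', ⟨hj', hn.sublist hq.sublist, hh', hlast'.trans hlast⟩,
        fun x hx => hst.trans (hts x (hts'.subset hx))⟩
    · cases p with
      | nil => simp at hh
      | cons a p =>
        obtain rfl : a = w := by simpa using hh
        refine ⟨u :: a :: p, t :: ts, ⟨.cons hl hj ?_, List.nodup_cons.2 ⟨hu, hn⟩, rfl, ?_⟩, ?_⟩
        · exact fun t' ht' => hts t' (List.mem_of_mem_head? ht')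
        · rwa [List.getLast?_cons_cons]
        · intro x hx
          rcases List.mem_cons.1 hx with rfl | hx
          · exact hst
          · exact hst.trans (hts x hx)

lemma TWalk.mono {G : TemporalGraph V} {s s' : ℚ} {u v : V} (h : G.TWalk s u v) (hs : s' ≤ s) :
    G.TWalk s' u v := by
  cases h with
  | refl => exact .refl _ _
  | step hst hl hw => exact .step (hs.trans hst) hl hw

lemma TWalk.reachable {G : TemporalGraph V} {s : ℚ} {u v : V} (h : G.TWalk s u v) :
    G.footprint.Reachable u v := by
  induction h with
  | refl s v => exact .refl v
  | @step s t u w v _ hl _ ih =>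
    have hadj : G.footprint.Adj u w := ⟨t, hl⟩
    exact hadj.reachable.trans ih

end TemporalGraph

variable {n k : ℕ} {φ : Fin k → Fin n → Option Bool}

instance : Finite (Vphi n k) := by
  let g : Fin n ⊕ Fin k ⊕ Fin 3 → Vphi n k
    | .inl i => .var i
    | .inr (.inl j) => .cls j
    | .inr (.inr m) => if m = 0 then .T else if m = 1 then .F else .B
  refine Finite.of_surjective g ?_
  rintro (i | j | _ | _ | _)
  · exact ⟨.inl i, rfl⟩
  · exact ⟨.inr (.inl j), rfl⟩
  · exact ⟨.inr (.inr 0), rfl⟩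
  · exact ⟨.inr (.inr 1), rfl⟩
  · exact ⟨.inr (.inr 2), rfl⟩

lemma tpos_pos (n k : ℕ) : 0 < tpos n k := by unfold tpos; positivity

lemma index_lt_tpos (i : Fin n) : (i : ℚ) + 1 < tpos n k := by
  have h : ((i : ℕ) : ℚ) + 1 ≤ n := by exact_mod_cast i.2
  have : (0 : ℚ) ≤ k := by positivity
  unfold tpos
  linarith

lemma index_add_index_lt_tpos (i : Fin n) (j : Fin k) :
    ((i : ℚ) + 1) + ((j : ℚ) + 1) < tpos n k := by
  have h : ((i : ℕ) : ℚ) + 1 ≤ n := by exact_mod_cast i.2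
  have h' : ((j : ℕ) : ℚ) + 1 ≤ k := by exact_mod_cast j.2
  unfold tpos
  linarith

/-! ### From an assignment to a spanning tree -/

/-- The parent of a vertex in the tree rooted at `B` given by an assignment `σ` and a choice `f`
of a variable for every clause. -/
def treeParent (σ : Fin n → Bool) (f : Fin k → Fin n) : Vphi n k → Vphi n k
  | .var i => if σ i then .T else .F
  | .cls j => .var (f j)
  | _ => .B

/-- The smaller label of the edge from a vertex to its parent. -/
def upTime (σ : Fin n → Bool) (f : Fin k → Fin n) : Vphi n k → ℚ
  | .var i => if σ i then tneg n k - ((i : ℚ) + 1) else -((i : ℚ) + 1)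
  | .cls j => if σ (f j) then tneg n k - (((f j : ℕ) : ℚ) + 1 + ((j : ℚ) + 1))
      else -(((f j : ℕ) : ℚ) + 1 + ((j : ℚ) + 1))
  | .T => tneg n k
  | .F => -eps
  | .B => 0

/-- The larger label of the edge from a vertex to its parent. -/
def downTime (σ : Fin n → Bool) (f : Fin k → Fin n) : Vphi n k → ℚ
  | .var i => if σ i then (i : ℚ) + 1 else tpos n k + ((i : ℚ) + 1)
  | .cls j => if σ (f j) then ((f j : ℕ) : ℚ) + 1 + ((j : ℚ) + 1)
      else tpos n k + (((f j : ℕ) : ℚ) + 1 + ((j : ℚ) + 1))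
  | .T => eps
  | .F => tpos n k
  | .B => 0

/-- The restriction of `G_φ` to the edges joining a vertex to its parent. -/
def treeGraph (φ : Fin k → Fin n → Option Bool) (σ : Fin n → Bool) (f : Fin k → Fin n) :
    TemporalGraph (Vphi n k) where
  label u v := if treeParent σ f u = v ∨ treeParent σ f v = u then (Gphi n k φ).label u v else ∅
  symm u v := by rw [(Gphi n k φ).symm, if_congr or_comm rfl rfl]
  loopless v := by rw [(Gphi n k φ).loopless, ite_self]

lemma times_mem_label {σ : Fin n → Bool} {f : Fin k → Fin n}
    (hf : ∀ j, φ j (f j) = some (σ (f j))) {v : Vphi n k} (hv : v ≠ .B) :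
    upTime σ f v ∈ (treeGraph φ σ f).label v (treeParent σ f v) ∧
      downTime σ f v ∈ (treeGraph φ σ f).label v (treeParent σ f v) := by
  rcases v with i | j | _ | _ | _
  · cases h : σ i <;> simp [treeGraph, treeParent, upTime, downTime, Gphi, corePhi, h]
  · have := hf j
    cases h : σ (f j) <;> rw [h] at this <;>
      simp [treeGraph, treeParent, upTime, downTime, Gphi, corePhi, h, this]
  · simp [treeGraph, treeParent, upTime, downTime, Gphi, corePhi]
  · simp [treeGraph, treeParent, upTime, downTime, Gphi, corePhi]
  · exact absurd rfl hv

lemma upTime_le (σ : Fin n → Bool) (f : Fin k → Fin n) (v : Vphi n k) :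
    upTime σ f v ≤ upTime σ f (treeParent σ f v) := by
  have := tpos_pos n k
  rcases v with i | j | _ | _ | _
  · have : (0 : ℚ) ≤ (i : ℕ) := by positivity
    cases h : σ i <;> simp [treeParent, upTime, h, eps] <;> linarith
  · have : (0 : ℚ) ≤ (j : ℕ) := by positivity
    cases h : σ (f j) <;> simp [treeParent, upTime, h] <;> linarith
  all_goals simp [treeParent, upTime, eps, tneg]
  linarith

lemma downTime_le (σ : Fin n → Bool) (f : Fin k → Fin n) (v : Vphi n k) :
    downTime σ f (treeParent σ f v) ≤ downTime σ f v := by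
  have := tpos_pos n k
  rcases v with i | j | _ | _ | _
  · have : (0 : ℚ) ≤ (i : ℕ) := by positivity
    cases h : σ i <;> simp [treeParent, downTime, h, eps] <;> linarith
  · have : (0 : ℚ) ≤ (j : ℕ) := by positivity
    cases h : σ (f j) <;> simp [treeParent, downTime, h] <;> linarith
  all_goals simp [treeParent, downTime, eps]
  linarith

/-- A property that holds at the root and passes from parents to children holds everywhere. -/
lemma treeParent_induction (σ : Fin n → Bool) (f : Fin k → Fin n) {P : Vphi n k → Prop}
    (root : P .B) (child : ∀ v, v ≠ .B → P (treeParent σ f v) → P v) (v : Vphi n k) : P v := by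
  have hT : P .T := child .T (by simp) root
  have hF : P .F := child .F (by simp) root
  have hvar : ∀ i, P (.var i) := fun i => child _ (by simp) (by
    cases h : σ i <;> simpa [treeParent, h])
  rcases v with i | j | _ | _ | _
  · exact hvar i
  · exact child _ (by simp) (hvar _)
  · exact hT
  · exact hF
  · exact root

lemma treeGraph_tWalk {σ : Fin n → Bool} {f : Fin k → Fin n}
    (hf : ∀ j, φ j (f j) = some (σ (f j))) (u v : Vphi n k) :
    ∃ s, (treeGraph φ σ f).TWalk s u v := by
  have down : ∀ v w, (treeGraph φ σ f).TWalk (downTime σ f v) v w →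
      (treeGraph φ σ f).TWalk 0 .B w := by
    refine treeParent_induction σ f (fun w h => h) ?_
    intro v hv ih w h
    refine ih w (.step (downTime_le σ f v) ?_ h)
    rw [TemporalGraph.symm]
    exact (times_mem_label hf hv).2
  have up : ∀ u, (treeGraph φ σ f).TWalk (upTime σ f u) u v := by
    refine treeParent_induction σ f (down v v (.refl _ v)) ?_
    intro u hu ih
    exact .step le_rfl (times_mem_label hf hu).1 (ih.mono (upTime_le σ f u))
  exact ⟨_, up u⟩

lemma treeGraph_footprint_isTree {σ : Fin n → Bool} {f : Fin k → Fin n}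
    (hf : ∀ j, φ j (f j) = some (σ (f j))) : (treeGraph φ σ f).footprint.IsTree := by
  have hconn : (treeGraph φ σ f).footprint.Connected :=
    (SimpleGraph.connected_iff _).2
      ⟨fun u v => (treeGraph_tWalk hf u v).choose_spec.reachable, ⟨.B⟩⟩
  refine SimpleGraph.isTree_iff_connected_and_card.2
    ⟨hconn, le_antisymm ?_ hconn.card_vert_le_card_edgeSet_add_one⟩
  have hsub : (treeGraph φ σ f).footprint.edgeSet ⊆
      (fun v => s(v, treeParent σ f v)) '' ({.B}ᶜ : Set (Vphi n k)) := by
    intro e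
    induction e with | h u v => ?_
    rintro ⟨t, ht⟩
    simp only [treeGraph] at ht
    split_ifs at ht with h
    · have root : ∀ w, t ∈ (Gphi n k φ).label .B w → treeParent σ f .B ≠ w := by
        rintro w hw rfl
        simp [treeParent, Gphi, corePhi] at hw
      rcases h with h | h
      · refine ⟨u, ?_, by simp [h]⟩
        rintro rfl
        exact root v ht h
      · refine ⟨v, ?_, by simp [h, Sym2.eq_swap]⟩
        rintro rfl
        exact root u ((Gphi n k φ).symm u .B ▸ ht) h
    · simp at ht
  have hle := (Set.ncard_le_ncard hsub).trans (Set.ncard_image_le (Set.toFinite _))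
  have hcompl := Set.ncard_add_ncard_compl ({.B} : Set (Vphi n k))
  rw [Set.ncard_singleton] at hcompl
  rw [Nat.card_coe_set_eq]
  lia

lemma exists_isSpanningTree_of_satisfiable (h : Satisfiable φ) :
    ∃ H : TemporalGraph (Vphi n k), H.IsSpanningTree (Gphi n k φ) := by
  obtain ⟨σ, hσ⟩ := h
  choose f b hf hb using hσ
  obtain rfl : (fun j => σ (f j)) = b := funext hb
  refine ⟨treeGraph φ σ f, ⟨?_, ?_⟩, treeGraph_footprint_isTree hf⟩
  · intro u v
    simp only [treeGraph]
    split_ifs <;> simp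
  · intro u v _
    obtain ⟨s, hs⟩ := treeGraph_tWalk hf u v
    obtain ⟨p, ts, hp, -⟩ := hs.exists_tPath
    exact ⟨p, ts, hp⟩

/-! ### From a spanning tree to an assignment -/

/-- The footprint of `H` with all edges at the vertex `B` removed. -/
def offB (H : TemporalGraph (Vphi n k)) : SimpleGraph (Vphi n k) where
  Adj u v := H.footprint.Adj u v ∧ u ≠ .B ∧ v ≠ .B
  symm := ⟨fun _ _ h => ⟨h.1.symm, h.2.2, h.2.1⟩⟩
  loopless := ⟨fun v h => H.footprint.loopless.irrefl v h.1⟩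

lemma eq_T_or_F_of_mem_label_B {u : Vphi n k} {t : ℚ} (h : t ∈ (Gphi n k φ).label u .B) :
    (u = .T ∧ (t = tneg n k ∨ t = eps)) ∨ (u = .F ∧ (t = -eps ∨ t = tpos n k)) := by
  rcases u with i | j | _ | _ | _ <;> simp [Gphi, corePhi] at h ⊢ <;> exact h

lemma mem_label_T {u : Vphi n k} {t : ℚ} (h : t ∈ (Gphi n k φ).label u .T) :
    t < tpos n k ∧ (u ≠ .B → t ≤ eps → t ≤ tneg n k) := by
  have := tpos_pos n k
  rcases u with i | j | _ | _ | _
  · have := index_lt_tpos (k := k) i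
    have : (0 : ℚ) ≤ (i : ℕ) := by positivity
    simp only [Gphi, corePhi, Finset.empty_union, Finset.mem_insert, Finset.mem_singleton,
      tneg, eps] at h ⊢
    rcases h with rfl | rfl
    · exact ⟨by linarith, fun _ _ => by linarith⟩
    · exact ⟨by linarith, fun _ _ => by linarith⟩
  · simp [Gphi, corePhi] at h
  · simp [Gphi, corePhi] at h
  · simp [Gphi, corePhi] at h
  · have h1 : (1 : ℚ) ≤ tpos n k := by
      unfold tpos
      have : (0 : ℚ) ≤ n + k := by positivity
      linarith
    simp only [Gphi, corePhi, Finset.union_empty, Finset.mem_insert, Finset.mem_singleton,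
      tneg, eps] at h ⊢
    refine ⟨?_, fun h => absurd rfl h⟩
    rcases h with rfl | rfl <;> linarith

lemma mem_label_F {u : Vphi n k} {t : ℚ} (h : t ∈ (Gphi n k φ).label .F u) :
    tneg n k < t ∧ (u ≠ .B → -eps ≤ t → tpos n k ≤ t) := by
  have := tpos_pos n k
  rcases u with i | j | _ | _ | _
  · have := index_lt_tpos (k := k) i
    have : (0 : ℚ) ≤ (i : ℕ) := by positivity
    simp only [Gphi, corePhi, Finset.union_empty, Finset.mem_insert, Finset.mem_singleton,
      tneg, eps] at h ⊢
    rcases h with rfl | rfl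
    · exact ⟨by linarith, fun _ _ => by linarith⟩
    · exact ⟨by linarith, fun _ _ => by linarith⟩
  · simp [Gphi, corePhi] at h
  · simp [Gphi, corePhi] at h
  · simp [Gphi, corePhi] at h
  · have h1 : (1 : ℚ) ≤ tpos n k := by
      unfold tpos
      have : (0 : ℚ) ≤ n + k := by positivity
      linarith
    simp only [Gphi, corePhi, Finset.empty_union, Finset.mem_insert, Finset.mem_singleton,
      tneg, eps] at h ⊢
    refine ⟨?_, fun h => absurd rfl h⟩
    rcases h with rfl | rfl <;> linarith

lemma mem_label_cls {j : Fin k} {u : Vphi n k} {t : ℚ}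
    (h : t ∈ (Gphi n k φ).label (.cls j) u) :
    ∃ i, u = .var i ∧ (t ≤ tneg n k → φ j i = some true) ∧
      (tpos n k ≤ t → φ j i = some false) := by
  rcases u with i | j | _ | _ | _
  · refine ⟨i, rfl, ?_⟩
    have := index_add_index_lt_tpos i j
    have : (0 : ℚ) ≤ (i : ℕ) := by positivity
    have : (0 : ℚ) ≤ (j : ℕ) := by positivity
    rcases hφ : φ j i with _ | _ | _ <;>
      simp [Gphi, corePhi, hφ, tneg] at h ⊢
    · rcases h with rfl | rfl <;> linarith
    · rcases h with rfl | rfl <;> linarith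
  all_goals simp [Gphi, corePhi] at h

/-- The first step of a temporal path ending in `B`, sorted by whether the path enters `B` from
`T` or from `F`. -/
lemma IsTJ.first_step_to_B {H : TemporalGraph (Vphi n k)} (hH : H.IsSubgraph (Gphi n k φ))
    {p : List (Vphi n k)} {ts : List ℚ} (h : H.IsTJ (· ≤ ·) p ts) (hn : p.Nodup)
    (hlast : p.getLast? = some .B) {u : Vphi n k} (hu : p.head? = some u) (huB : u ≠ .B) :
    ∃ v t, t ∈ ts.head? ∧ t ∈ H.label u v ∧
      (((offB H).Reachable u .T ∧ t ≤ eps ∧ (u ≠ .T → t ≤ tneg n k) ∧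
          (v ≠ .B → (offB H).Reachable v .T)) ∨
        ((offB H).Reachable u .F ∧ H.footprint.Adj .F .B)) := by
  have hneg : tneg n k ≤ eps := by
    have := tpos_pos n k
    simp only [tneg, eps]
    linarith
  induction h generalizing u with
  | single v => simp_all
  | @cons a v p t ts hl hj hr ih =>
    obtain rfl : a = u := by simpa using hu
    refine ⟨v, t, rfl, hl, ?_⟩
    by_cases hv : v = .B
    · subst hv
      rcases eq_T_or_F_of_mem_label_B (hH _ _ hl) with ⟨rfl, ht⟩ | ⟨rfl, ht⟩
      · refine .inl ⟨.refl _, ?_, fun h => absurd rfl h, fun h => absurd rfl h⟩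
        rcases ht with rfl | rfl
        · exact hneg
        · exact le_rfl
      · exact .inr ⟨.refl _, t, hl⟩
    · rw [List.getLast?_cons_cons] at hlast
      have hadj : (offB H).Adj a v := ⟨⟨t, hl⟩, huB, hv⟩
      obtain ⟨w, t', ht', -, ⟨hvT, heps, hle, -⟩ | ⟨hvF, hFB⟩⟩ :=
        ih (List.nodup_cons.1 hn).2 hlast rfl hv
      · have htt : t ≤ t' := hr t' ht'
        refine .inl ⟨hadj.reachable.trans hvT, htt.trans heps, fun _ => ?_, fun _ => hvT⟩
        by_cases hvT' : v = .T
        · subst hvT'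
          exact (mem_label_T (hH _ _ hl)).2 huB (htt.trans heps)
        · exact htt.trans (hle hvT')
      · exact .inr ⟨hadj.reachable.trans hvF, hFB⟩

/-- The last step of a temporal path that avoids `B` and continues a path leaving `B`
through `F`. -/
lemma IsTJ.last_step_of_reachable_F {H : TemporalGraph (Vphi n k)}
    (hH : H.IsSubgraph (Gphi n k φ)) {p : List (Vphi n k)} {ts : List ℚ}
    (h : H.IsTJ (· ≤ ·) p ts) (hB : .B ∉ p) {u v : Vphi n k} {s : ℚ}
    (hv : p.head? = some v) (hlast : p.getLast? = some u) (hs : ∀ t ∈ ts.head?, s ≤ t)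
    (hvF : (offB H).Reachable v .F) (heps : -eps ≤ s) (hle : v ≠ .F → tpos n k ≤ s) :
    (offB H).Reachable u .F ∧
      (u = v ∨ ∃ w t, t ∈ H.label w u ∧ (offB H).Reachable w .F ∧ tpos n k ≤ t) := by
  induction h generalizing v s with
  | single x => simp_all
  | @cons a b p t ts hl hj hr ih =>
    obtain rfl : a = v := by simpa using hv
    rw [List.getLast?_cons_cons] at hlast
    have hst : s ≤ t := hs t rfl
    have haB : a ≠ .B := by rintro rfl; simp at hB
    have hbB : b ≠ .B := by rintro rfl; simp at hB
    have hadj : (offB H).Adj b a := ⟨⟨t, H.symm a b ▸ hl⟩, hbB, haB⟩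
    have htpos : tpos n k ≤ t := by
      by_cases haF : a = .F
      · subst haF
        exact (mem_label_F (hH _ _ hl)).2 hbB (heps.trans hst)
      · exact (hle haF).trans hst
    obtain ⟨huF, rfl | hw⟩ := ih (fun h => hB (List.mem_cons_of_mem _ h)) rfl hlast hr
      (hadj.reachable.trans hvF) (heps.trans hst) (fun _ => htpos)
    · exact ⟨huF, .inr ⟨a, t, hl, hvF, htpos⟩⟩
    · exact ⟨huF, .inr hw⟩

lemma IsTJ.reachable_offB {H : TemporalGraph (Vphi n k)} {r : ℚ → ℚ → Prop}
    {p : List (Vphi n k)} {ts : List ℚ} (h : H.IsTJ r p ts) (hB : .B ∉ p) {u v : Vphi n k}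
    (hv : p.head? = some v) (hlast : p.getLast? = some u) : (offB H).Reachable v u := by
  induction h generalizing v with
  | single x =>
    obtain rfl : x = v := by simpa using hv
    obtain rfl : x = u := by simpa using hlast
    exact .refl _
  | @cons a b p t ts hl hj hr ih =>
    obtain rfl : a = v := by simpa using hv
    rw [List.getLast?_cons_cons] at hlast
    have haB : a ≠ .B := by rintro rfl; simp at hB
    have hbB : b ≠ .B := by rintro rfl; simp at hB
    have hadj : (offB H).Adj a b := ⟨⟨t, hl⟩, haB, hbB⟩
    exact hadj.reachable.trans (ih (fun h => hB (List.mem_cons_of_mem _ h)) rfl hlast)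

/-- The last step of a temporal path starting in `B`, sorted by whether the path leaves `B`
towards `T` or towards `F`. -/
lemma Reach.last_step_from_B {H : TemporalGraph (Vphi n k)}
    (hH : H.IsSubgraph (Gphi n k φ)) {u : Vphi n k} (huB : u ≠ .B)
    (h : H.Reach (· ≤ ·) .B u) :
    ((offB H).Reachable u .T ∧ H.footprint.Adj .B .T) ∨
      ((offB H).Reachable u .F ∧
        (u = .F ∨ ∃ w t, t ∈ H.label w u ∧ (offB H).Reachable w .F ∧ tpos n k ≤ t)) := by
  obtain ⟨p, ts, hj, hn, hh, hlast⟩ := h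
  cases hj with
  | single x => simp_all
  | @cons a b p t ts hl hj hr =>
    obtain rfl : a = .B := by simpa using hh
    rw [List.getLast?_cons_cons] at hlast
    have hB := (List.nodup_cons.1 hn).1
    have hpos := tpos_pos n k
    have hl' := hH _ _ (H.symm .B b ▸ hl)
    rcases eq_T_or_F_of_mem_label_B hl' with ⟨rfl, -⟩ | ⟨rfl, ht⟩
    · exact .inl ⟨(IsTJ.reachable_offB hj hB rfl hlast).symm, t, hl⟩
    · refine .inr (IsTJ.last_step_of_reachable_F hH hj hB rfl hlast hr (.refl _) ?_
        (fun h => absurd rfl h))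
      rcases ht with rfl | rfl
      · exact le_rfl
      · simp only [eps]
        linarith

lemma satisfiable_of_isSpanningTree {H : TemporalGraph (Vphi n k)}
    (h : H.IsSpanningTree (Gphi n k φ)) : Satisfiable φ := by
  classical
  obtain ⟨⟨hH, hconn⟩, htree⟩ := h
  have toB : ∀ u : Vphi n k, u ≠ .B → ∃ v t, t ∈ H.label u v ∧
      (((offB H).Reachable u .T ∧ t ≤ eps ∧ (u ≠ .T → t ≤ tneg n k) ∧
          (v ≠ .B → (offB H).Reachable v .T)) ∨
        ((offB H).Reachable u .F ∧ H.footprint.Adj .F .B)) := by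
    intro u hu
    obtain ⟨p, ts, hj, hn, hh, hlast⟩ := hconn u .B hu
    obtain ⟨v, t, -, hl, hvt⟩ := IsTJ.first_step_to_B hH hj hn hlast hh hu
    exact ⟨v, t, hl, hvt⟩
  have fromB := fun (u : Vphi n k) (hu : u ≠ .B) =>
    Reach.last_step_from_B hH hu (hconn .B u hu.symm)
  have hBT : H.footprint.Adj .B .T := by
    rcases fromB .T (by simp) with h | ⟨-, h | ⟨w, t, hl, -, ht⟩⟩
    · exact h.2
    · simp at h
    · exact absurd ht (mem_label_T (hH _ _ hl)).1.not_ge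
  have hFB : H.footprint.Adj .F .B := by
    obtain ⟨v, t, hl, ⟨-, -, ht, -⟩ | h⟩ := toB .F (by simp)
    · exact absurd (ht (by simp)) (mem_label_F (hH _ _ hl)).1.not_ge
    · exact h.2
  have hTF : ¬ (offB H).Reachable .T .F := by
    intro hr
    have hbr := SimpleGraph.isAcyclic_iff_forall_adj_isBridge.1 htree.isAcyclic hBT.symm
    have hle : offB H ≤ H.footprint.deleteEdges {s(.T, .B)} := by
      intro u v huv
      rw [SimpleGraph.deleteEdges_adj]
      refine ⟨huv.1, fun h => ?_⟩
      rcases Sym2.eq_iff.1 (Set.mem_singleton_iff.1 h) with h | h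
      · exact huv.2.2 h.2
      · exact huv.2.1 h.1
    have hadj : (H.footprint.deleteEdges {s(.T, .B)}).Adj .F .B := by
      rw [SimpleGraph.deleteEdges_adj]
      exact ⟨hFB, by simp⟩
    exact SimpleGraph.isBridge_iff.1 hbr ((hr.mono hle).trans hadj.reachable)
  refine ⟨fun i => decide ((offB H).Reachable (.var i) .T), fun j => ?_⟩
  obtain ⟨v, t, hl, ⟨-, -, ht, hv⟩ | ⟨hF, -⟩⟩ := toB (.cls j) (by simp)
  · obtain ⟨i, rfl, hi, -⟩ := mem_label_cls (hH _ _ hl)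
    exact ⟨i, true, hi (ht (by simp)), by simpa using hv (by simp)⟩
  · rcases fromB (.cls j) (by simp) with ⟨hT, -⟩ | ⟨-, h | ⟨w, t, hl, hw, ht⟩⟩
    · exact absurd (hT.symm.trans hF) hTF
    · simp at h
    · obtain ⟨i, rfl, -, hi⟩ := mem_label_cls (hH _ _ (H.symm _ _ ▸ hl))
      exact ⟨i, false, hi ht, by simpa using fun hT => hTF (hT.symm.trans hw)⟩

/-- Theorem 1, correctness of the reduction: `G_φ` admits a temporal
spanning tree if and only if the CNF formula `φ` is satisfiable. -/
theorem stmt15 (n k : ℕ) (φ : Fin k → Fin n → Option Bool) :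
    (∃ H : TemporalGraph (Vphi n k), H.IsSpanningTree (Gphi n k φ)) ↔
    Satisfiable φ :=
  ⟨fun ⟨_, h⟩ => satisfiable_of_isSpanningTree h, exists_isSpanningTree_of_satisfiable⟩

end TemporalPaper
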